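/- Let u : ℝ² → ℝ be smooth on a neighborhood of (0,0) and f : ℝ → ℝ smooth on a neighborhood of 0. Let k ≥ 1 and l ≥ 2 be integers and suppose: (a) ∂^i_{x₁}∂^j_{x₂} u(0,0) = 0 for all i + j < k; (b) f^(s)(0) = 0 for all 0 ≤ s ≤ l−1; (c) u(t, f(t)) = 0 for all t in a neighborhood of 0. Then ∂^{k+l−1}_{x₁} u(0,0) = − binom(k+l−1, k−1) · ∂^{k−1}_{x₁}∂_{x₂} u(0,0) · f^(l)(0). -/

import Mathlib

open Real Filter Topology Set

noncomputable section

/-- The iterated partial derivative `∂^i_{x₁} ∂^j_{x₂} u (0,0)`. -/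
def pd (u : ℝ × ℝ → ℝ) (i j : ℕ) : ℝ :=
  iteratedDeriv i (fun a => iteratedDeriv j (fun b => u (a, b)) 0) 0

open Asymptotics

/-- **Taylor's theorem** on a symmetric interval, with a bound that is uniform in the function. -/
theorem abs_sub_taylor_sum_le {r C : ℝ} {m : ℕ} {F : ℝ → ℝ}
    (hF : ∀ y, |y| < r → ContDiffAt ℝ (⊤ : ℕ∞) F y)
    (hC : ∀ y, |y| < r → |iteratedDeriv m F y| ≤ C) {y : ℝ} (hy : |y| < r) :
    |F y - ∑ j ∈ Finset.range m, iteratedDeriv j F 0 / (j.factorial : ℝ) * y ^ j|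
      ≤ C * |y| ^ m := by
  induction m generalizing F y with
  | zero => simpa using hC y hy
  | succ m ih =>
    have hC0 : 0 ≤ C := (abs_nonneg _).trans (hC y hy)
    have hF' : ∀ z, |z| < r → ContDiffAt ℝ (⊤ : ℕ∞) (deriv F) z := fun z hz ↦ by
      have h := ((hF z hz).fderiv_right (m := (⊤ : ℕ∞)) (by simp)).clm_apply
        (contDiffAt_const (c := (1 : ℝ)))
      simpa using h
    have hbound := fun z hz ↦ ih (y := z) hF' (fun w hw ↦ by
      rw [← iteratedDeriv_succ']; exact hC w hw) hz
    have hder : ∀ z ∈ Metric.closedBall (0 : ℝ) |y|, HasDerivWithinAt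
        (fun z ↦ F z - ∑ j ∈ Finset.range (m + 1),
          iteratedDeriv j F 0 / (j.factorial : ℝ) * z ^ j)
        (deriv F z - ∑ j ∈ Finset.range m,
          iteratedDeriv j (deriv F) 0 / (j.factorial : ℝ) * z ^ j)
        (Metric.closedBall (0 : ℝ) |y|) z := fun z hz ↦ by
      have hz' : |z| < r := lt_of_le_of_lt (by simpa using hz) hy
      refine (((hF z hz').differentiableAt (by simp)).hasDerivAt.sub ?_).hasDerivWithinAt
      have h := HasDerivAt.fun_sum (u := Finset.range (m + 1)) (x := z)
        (A := fun j z ↦ iteratedDeriv j F 0 / (j.factorial : ℝ) * z ^ j)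
        (A' := fun j ↦ iteratedDeriv j F 0 / (j.factorial : ℝ) * (j * z ^ (j - 1)))
        (fun j _ ↦ (hasDerivAt_pow j z).const_mul _)
      convert h using 1
      rw [Finset.sum_range_succ']
      simp only [CharP.cast_eq_zero, zero_mul, mul_zero, add_zero, Nat.add_sub_cancel]
      refine Finset.sum_congr rfl fun j _ ↦ ?_
      rw [iteratedDeriv_succ', Nat.factorial_succ]
      push_cast
      field_simp
    have h := (convex_closedBall (0 : ℝ) |y|).norm_image_sub_le_of_norm_hasDerivWithin_le
      (C := C * |y| ^ m) hder (fun z hz ↦ by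
        have hz' : |z| ≤ |y| := by simpa using hz
        exact (hbound z (hz'.trans_lt hy)).trans (by gcongr))
      (x := 0) (y := y) (by simp) (by simp)
    have h0 : F 0 - ∑ j ∈ Finset.range (m + 1),
        iteratedDeriv j F 0 / (j.factorial : ℝ) * 0 ^ j = 0 := by
      simp [Finset.sum_range_succ']
    rw [h0] at h
    simpa [pow_succ, mul_assoc] using h

theorem eventually_contDiffAt_of_contDiffOn_nhds {E : Type*} [NormedAddCommGroup E] [NormedSpace ℝ E]
    {u : E → ℝ} {x : E} (h : ∃ s ∈ 𝓝 x, ContDiffOn ℝ (⊤ : ℕ∞) u s) :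
    ∀ᶠ y in 𝓝 x, ContDiffAt ℝ (⊤ : ℕ∞) u y := by
  obtain ⟨s, hs, hu⟩ := h
  filter_upwards [eventually_mem_nhds_iff.2 hs] with y hy using hu.contDiffAt hy

/-- Iterated partial derivatives in the second variable of a smooth function are smooth. -/
theorem eventually_contDiffAt_iteratedDeriv_snd {u : ℝ × ℝ → ℝ} {x : ℝ × ℝ}
    (hu : ∀ᶠ p in 𝓝 x, ContDiffAt ℝ (⊤ : ℕ∞) u p) (j : ℕ) :
    ∀ᶠ p in 𝓝 x, ContDiffAt ℝ (⊤ : ℕ∞)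
      (fun p : ℝ × ℝ ↦ iteratedDeriv j (fun b ↦ u (p.1, b)) p.2) p := by
  induction j with
  | zero => simpa using hu
  | succ j ih =>
    filter_upwards [ih.eventually_nhds] with p hp
    set w := fun p : ℝ × ℝ ↦ iteratedDeriv j (fun b ↦ u (p.1, b)) p.2 with hw
    have h := (hp.self_of_nhds.fderiv_right (m := (⊤ : ℕ∞)) (by simp)).clm_apply
        (contDiffAt_const (c := ((0, 1) : ℝ × ℝ)))
    refine h.congr_of_eventuallyEq ?_
    filter_upwards [hp] with q hq
    have h1 : HasFDerivAt w (fderiv ℝ w q) (q.1, q.2) :=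
      (hq.differentiableAt (by simp)).hasFDerivAt
    have h2 : HasDerivAt (fun b : ℝ ↦ (q.1, b)) ((0, 1) : ℝ × ℝ) q.2 :=
      (hasDerivAt_const _ _).prodMk (hasDerivAt_id _)
    rw [iteratedDeriv_succ]
    exact (h1.comp_hasDerivAt q.2 h2).deriv

theorem isBigO_sub_taylor_sum {g : ℝ → ℝ} (hg : ∀ᶠ t in 𝓝 0, ContDiffAt ℝ (⊤ : ℕ∞) g t)
    (n : ℕ) :
    (fun t ↦ g t - ∑ j ∈ Finset.range n, iteratedDeriv j g 0 / (j.factorial : ℝ) * t ^ j)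
      =O[𝓝 0] fun t ↦ t ^ n := by
  have hcont : ContinuousAt (iteratedDeriv n g) 0 := by
    have hG : ∀ᶠ p in 𝓝 ((0, 0) : ℝ × ℝ), ContDiffAt ℝ (⊤ : ℕ∞) (fun p ↦ g p.2) p := by
      filter_upwards [(continuous_snd.tendsto ((0, 0) : ℝ × ℝ)).eventually hg] with p hp
      exact ContDiffAt.comp p hp contDiffAt_snd
    have h := (eventually_contDiffAt_iteratedDeriv_snd hG n).self_of_nhds.continuousAt
    exact ContinuousAt.comp (f := fun t : ℝ ↦ ((0 : ℝ), t)) (x := 0) h (by fun_prop)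
  have hb : ∀ᶠ t in 𝓝 (0 : ℝ), |iteratedDeriv n g t| < |iteratedDeriv n g 0| + 1 :=
    hcont.abs.eventually_lt_const (lt_add_one _)
  obtain ⟨r, hr, h⟩ := Metric.eventually_nhds_iff.1 (hg.and hb)
  simp only [dist_zero_right, Real.norm_eq_abs] at h
  refine IsBigO.of_bound (|iteratedDeriv n g 0| + 1) ?_
  filter_upwards [Metric.ball_mem_nhds (0 : ℝ) hr] with t ht
  rw [norm_pow, Real.norm_eq_abs, Real.norm_eq_abs]
  exact abs_sub_taylor_sum_le (fun y hy ↦ (h hy).1) (fun y hy ↦ (h hy).2.le) (by simpa using ht)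

theorem isBigO_pow_of_iteratedDeriv_eq_zero {g : ℝ → ℝ}
    (hg : ∀ᶠ t in 𝓝 0, ContDiffAt ℝ (⊤ : ℕ∞) g t) {n : ℕ}
    (h : ∀ i < n, iteratedDeriv i g 0 = 0) : g =O[𝓝 0] fun t ↦ t ^ n := by
  refine (isBigO_sub_taylor_sum hg n).congr_left fun t ↦ ?_
  rw [Finset.sum_eq_zero fun j hj ↦ by rw [h j (Finset.mem_range.1 hj)]; simp, sub_zero]

theorem isBigO_pow_pow_nhds_zero {m n : ℕ} (h : m ≤ n) :
    (fun t : ℝ ↦ t ^ n) =O[𝓝 0] fun t ↦ t ^ m := by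
  rcases h.eq_or_lt with rfl | h
  · exact isBigO_refl _ _
  · exact (isLittleO_pow_pow h).isBigO

theorem iteratedDeriv_eq_zero_of_isBigO_pow {g : ℝ → ℝ}
    (hg : ∀ᶠ t in 𝓝 0, ContDiffAt ℝ (⊤ : ℕ∞) g t) {n : ℕ} (h : g =O[𝓝 0] fun t ↦ t ^ n)
    {i : ℕ} (hi : i < n) : iteratedDeriv i g 0 = 0 := by
  induction i using Nat.strong_induction_on with
  | _ i ih =>
    have h1 := (h.trans (isBigO_pow_pow_nhds_zero hi)).sub (isBigO_sub_taylor_sum hg (i + 1))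
    have h2 : (fun t : ℝ ↦ iteratedDeriv i g 0 / (i.factorial : ℝ) * t ^ i)
        =o[𝓝 0] fun t ↦ t ^ i := by
      refine (h1.trans_isLittleO (isLittleO_pow_pow i.lt_succ_self)).congr_left fun t ↦ ?_
      rw [Finset.sum_range_succ, Finset.sum_eq_zero fun j hj ↦ by
        rw [ih j (Finset.mem_range.1 hj) ((Finset.mem_range.1 hj).trans hi)]; simp]
      ring
    by_contra hne
    have hc : iteratedDeriv i g 0 / (i.factorial : ℝ) ≠ 0 := by positivity
    rw [isLittleO_const_mul_left_iff hc] at h2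
    refine isLittleO_irrefl (l := 𝓝[≠] (0 : ℝ)) ?_ (h2.mono nhdsWithin_le_nhds)
    refine (eventually_mem_nhdsWithin.mono fun t ht ↦ ?_).frequently
    exact pow_ne_zero i ht

/-- The Taylor expansion of a smooth function of two variables in the second variable, along a
curve tending to the origin. -/
theorem isBigO_sub_taylor_sum_snd {u : ℝ × ℝ → ℝ}
    (hu : ∀ᶠ p in 𝓝 ((0, 0) : ℝ × ℝ), ContDiffAt ℝ (⊤ : ℕ∞) u p) {f : ℝ → ℝ}
    (hf : Tendsto f (𝓝 0) (𝓝 0)) (m : ℕ) :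
    (fun t ↦ u (t, f t) - ∑ j ∈ Finset.range m,
      iteratedDeriv j (fun b ↦ u (t, b)) 0 / (j.factorial : ℝ) * f t ^ j)
      =O[𝓝 0] fun t ↦ f t ^ m := by
  set D := fun p : ℝ × ℝ ↦ iteratedDeriv m (fun b ↦ u (p.1, b)) p.2 with hD
  have hb : ∀ᶠ p in 𝓝 ((0, 0) : ℝ × ℝ), |D p| < |D (0, 0)| + 1 :=
    (eventually_contDiffAt_iteratedDeriv_snd hu m).self_of_nhds.continuousAt.abs.eventually_lt_const
      (lt_add_one _)
  obtain ⟨r, hr, h⟩ := Metric.eventually_nhds_iff.1 (hu.and hb)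
  simp only [Prod.dist_eq, dist_zero_right, Real.norm_eq_abs, max_lt_iff] at h
  refine IsBigO.of_bound (|D (0, 0)| + 1) ?_
  filter_upwards [Metric.ball_mem_nhds (0 : ℝ) hr, hf (Metric.ball_mem_nhds (0 : ℝ) hr)]
    with t ht hft
  have ht' : |t| < r := by simpa using ht
  rw [norm_pow, Real.norm_eq_abs, Real.norm_eq_abs]
  refine abs_sub_taylor_sum_le (F := fun b ↦ u (t, b)) (fun y hy ↦ ?_)
    (fun y hy ↦ (h (y := (t, y)) ⟨ht', hy⟩).2.le) (by simpa using hft)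
  exact ContDiffAt.comp y (h (y := (t, y)) ⟨ht', hy⟩).1 (by fun_prop)

theorem eventually_contDiffAt_iteratedDeriv_snd_axis {u : ℝ × ℝ → ℝ}
    (hu : ∀ᶠ p in 𝓝 ((0, 0) : ℝ × ℝ), ContDiffAt ℝ (⊤ : ℕ∞) u p) (j : ℕ) :
    ∀ᶠ t in 𝓝 (0 : ℝ), ContDiffAt ℝ (⊤ : ℕ∞)
      (fun a ↦ iteratedDeriv j (fun b ↦ u (a, b)) 0) t := by
  have hc : Tendsto (fun t : ℝ ↦ (t, (0 : ℝ))) (𝓝 0) (𝓝 (0, 0)) :=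
    (by fun_prop : Continuous fun t : ℝ ↦ (t, (0 : ℝ))).tendsto 0
  filter_upwards [hc.eventually (eventually_contDiffAt_iteratedDeriv_snd hu j)] with t ht
  exact ContDiffAt.comp (f := fun t : ℝ ↦ (t, (0 : ℝ))) t ht (by fun_prop)

/-- The first nonzero pure `x₁`-derivative of `u` at the origin:
`∂^{k+l−1}_{x₁} u(0,0) = − C(k+l−1, k−1) · ∂^{k−1}_{x₁}∂_{x₂} u(0,0) · f^{(l)}(0)`. -/
theorem pure_x1_derivative_formula
    (u : ℝ × ℝ → ℝ) (hu : ∃ s ∈ 𝓝 ((0, 0) : ℝ × ℝ), ContDiffOn ℝ (⊤ : ℕ∞) u s)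
    (f : ℝ → ℝ) (hf : ∃ s ∈ 𝓝 (0 : ℝ), ContDiffOn ℝ (⊤ : ℕ∞) f s)
    (k l : ℕ) (hk : 1 ≤ k) (hl : 2 ≤ l)
    (ha : ∀ i j : ℕ, i + j < k → pd u i j = 0)
    (hb : ∀ s : ℕ, s ≤ l - 1 → iteratedDeriv s f 0 = 0)
    (hc : ∀ᶠ t in 𝓝 (0 : ℝ), u (t, f t) = 0) :
    pd u (k + l - 1) 0 =
      -(((k + l - 1).choose (k - 1) : ℝ) * pd u (k - 1) 1 * iteratedDeriv l f 0) := by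
  replace hu := eventually_contDiffAt_of_contDiffOn_nhds hu
  replace hf := eventually_contDiffAt_of_contDiffOn_nhds hf
  set g : ℕ → ℝ → ℝ := fun j a ↦ iteratedDeriv j (fun b ↦ u (a, b)) 0 with hg
  have hgs : ∀ j, ∀ᶠ t in 𝓝 (0 : ℝ), ContDiffAt ℝ (⊤ : ℕ∞) (g j) t :=
    eventually_contDiffAt_iteratedDeriv_snd_axis hu
  have hfO : f =O[𝓝 0] fun t ↦ t ^ l :=
    isBigO_pow_of_iteratedDeriv_eq_zero hf fun i hi ↦ hb i (by omega)
  have hgO : ∀ j, g j =O[𝓝 0] fun t ↦ t ^ (k - j) := fun j ↦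
    isBigO_pow_of_iteratedDeriv_eq_zero (hgs j) fun i hi ↦ ha i j (by omega)
  have hf0 : f 0 = 0 := by simpa using hb 0 (by omega)
  have hft : Tendsto f (𝓝 0) (𝓝 0) := by
    simpa [hf0] using hf.self_of_nhds.continuousAt.tendsto
  obtain ⟨m, hm⟩ : ∃ m, k + l = m + 2 := ⟨k + l - 2, by omega⟩
  have hfpow : ∀ j, (fun t ↦ f t ^ j) =O[𝓝 0] fun t ↦ t ^ (l * j) := fun j ↦ by
    simpa only [pow_mul] using hfO.pow j
  have hrem := (isBigO_sub_taylor_sum_snd hu hft (m + 2)).trans ((hfpow (m + 2)).trans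
    (isBigO_pow_pow_nhds_zero (show k + l ≤ l * (m + 2) by nlinarith)))
  have htail : (fun t ↦ ∑ j ∈ Finset.range m,
      g (j + 2) t / ((j + 2).factorial : ℝ) * f t ^ (j + 2)) =O[𝓝 0] fun t ↦ t ^ (k + l) := by
    refine IsBigO.fun_sum fun j _ ↦ ?_
    have h := ((hgO (j + 2)).const_mul_left ((j + 2).factorial : ℝ)⁻¹).mul (hfpow (j + 2))
    simp only [← pow_add] at h
    refine (h.trans (isBigO_pow_pow_nhds_zero ?_)).congr_left fun t ↦ by ring
    have h1 : k ≤ (k - (j + 2)) + (j + 2) := by omega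
    nlinarith [Nat.mul_le_mul_left (j + 1) hl]
  have hmain : (g 0 + g 1 * f) =O[𝓝 0] fun t ↦ t ^ (k + l) := by
    refine (isBigO_neg_left.2 (hrem.add htail)).congr' ?_ EventuallyEq.rfl
    filter_upwards [hc] with t ht
    rw [ht, Finset.sum_range_succ', Finset.sum_range_succ']
    simp [hg, add_assoc]
    ring
  have hsm : ∀ᶠ t in 𝓝 (0 : ℝ), ContDiffAt ℝ (⊤ : ℕ∞) (g 0 + g 1 * f) t := by
    filter_upwards [hgs 0, hgs 1, hf] with t h0 h1 h2 using h0.add (h1.mul h2)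
  have hzero := iteratedDeriv_eq_zero_of_isBigO_pow hsm hmain (i := k + l - 1) (by omega)
  have fin : ∀ {F : ℝ → ℝ}, (∀ᶠ t in 𝓝 (0 : ℝ), ContDiffAt ℝ (⊤ : ℕ∞) F t) →
      ContDiffAt ℝ ((k + l - 1 : ℕ) : WithTop ℕ∞) F 0 := fun h ↦
    contDiffAt_infty.1 h.self_of_nhds _
  have hmul : ContDiffAt ℝ ((k + l - 1 : ℕ) : WithTop ℕ∞) (g 1 * f) 0 :=
    (fin (hgs 1)).mul (fin hf)
  rw [iteratedDeriv_add (fin (hgs 0)) hmul,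
    iteratedDeriv_mul (fin (hgs 1)) (fin hf), Finset.sum_eq_single (k - 1)] at hzero
  · rw [show k + l - 1 - (k - 1) = l by omega] at hzero
    exact eq_neg_of_add_eq_zero_left hzero
  · intro i hi hne
    rcases lt_or_gt_of_ne hne with h | h
    · have := ha i 1 (by omega)
      rw [pd] at this
      simp only [hg, this]
      simp
    · rw [hb (k + l - 1 - i) (by omega), mul_zero]
  · intro h
    exact absurd (Finset.mem_range.2 (by omega)) h
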